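/- There exist real numbers x2, x12, x13 with 0.24 < x2 < 0.25, 1.01 < x12 < 1.02 and 0.25 < x13 < 0.26 satisfying F1 = 0, F2 = 0 and F3 = 0, and there exist real numbers x2, x12, x13 with 0.28 < x2 < 0.30, 0.66 < x12 < 0.68 and 1.15 < x13 < 1.17 satisfying F1 = 0, F2 = 0 and F3 = 0; in particular the system has two distinct solutions in positive reals with x13 ≠ 1. -/

import Mathlib

/-- `F1` from the Einstein equations for `V₅ℝ⁷ = SO(7)/SO(2)`
(Ad(SO(4)×SO(2))-invariant metrics, normalization `x23 = 1`). -/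
def F1 (x2 x12 x13 : ℝ) : ℝ :=
  -x12 ^ 3 * x2 + x12 ^ 2 * x13 * x2 ^ 2 + x12 ^ 2 * x13 + x12 * x13 ^ 2 * x2
    - 5 * x12 * x13 * x2 + x12 * x2 + 2 * x13 * x2 ^ 2

/-- `F2` from the Einstein equations for `V₅ℝ⁷`. -/
def F2 (x2 x12 x13 : ℝ) : ℝ :=
  3 * x12 ^ 3 + 3 * x12 ^ 2 * x13 * x2 - 10 * x12 ^ 2 * x13 - x12 * x13 ^ 2
    + 10 * x12 * x13 - 3 * x12 - 3 * x13 * x2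

/-- `F3` from the Einstein equations for `V₅ℝ⁷`. -/
def F3 (x2 x12 x13 : ℝ) : ℝ :=
  3 * x12 ^ 2 - 3 * x12 * x13 * x2 + 10 * x12 * x13 - 10 * x12 - 5 * x13 ^ 2 + 5

/-- The discriminant (divided by four) in `x13` of the elimination of `x2` from `F2` and `F3`. -/
def elimDiscr (a : ℝ) : ℝ :=
  25 * a ^ 2 * (a - 1) ^ 2 - (5 - 6 * a ^ 2) * (a ^ 2 - 1) * (6 * a ^ 2 - 10 * a + 5)

/-- The value of `x13` on the curve `F2 = F3 = 0` over `x12 = a`, with `σ = ±1` selecting a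
branch. -/
noncomputable def branch (σ a : ℝ) : ℝ :=
  (-5 * a * (a - 1) + σ * √(elimDiscr a)) / (5 - 6 * a ^ 2)

/-- The numerator of `x2` when `F3 = 0` is solved for `x2`. -/
def numer (a b : ℝ) : ℝ :=
  3 * a ^ 2 + 10 * a * b - 10 * a - 5 * b ^ 2 + 5

/-- `9 * x12 ^ 2 * x13 * F1` with `x2` eliminated by means of `F3 = 0`. -/
def reducedF1 (a b : ℝ) : ℝ :=
  3 * a * numer a b * (-a ^ 3 + a * b ^ 2 - 5 * a * b + a) + numer a b ^ 2 * (a ^ 2 + 2)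
    + 9 * a ^ 4 * b ^ 2

lemma branch_root {σ a : ℝ} (hσ : σ ^ 2 = 1) (hD : 0 ≤ elimDiscr a) (ha : 5 - 6 * a ^ 2 ≠ 0) :
    (5 - 6 * a ^ 2) * branch σ a ^ 2 + 10 * a * (a - 1) * branch σ a
      + (a ^ 2 - 1) * (6 * a ^ 2 - 10 * a + 5) = 0 := by
  have hb : branch σ a * (5 - 6 * a ^ 2) = -5 * a * (a - 1) + σ * √(elimDiscr a) :=
    div_mul_cancel₀ _ ha
  have hs : √(elimDiscr a) ^ 2 = elimDiscr a := Real.sq_sqrt hD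
  apply mul_left_cancel₀ ha
  unfold elimDiscr at hs hb
  linear_combination
    (branch σ a * (5 - 6 * a ^ 2) + 10 * a * (a - 1) - 5 * a * (a - 1)
      + σ * √(25 * a ^ 2 * (a - 1) ^ 2 - (5 - 6 * a ^ 2) * (a ^ 2 - 1) * (6 * a ^ 2 - 10 * a + 5)))
      * hb + σ ^ 2 * hs
      + (25 * a ^ 2 * (a - 1) ^ 2 - (5 - 6 * a ^ 2) * (a ^ 2 - 1) * (6 * a ^ 2 - 10 * a + 5)) * hσ

lemma solution_of_reducedF1_eq_zero {a b : ℝ} (ha : 0 < a) (hb : 0 < b)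
    (hq : (5 - 6 * a ^ 2) * b ^ 2 + 10 * a * (a - 1) * b
      + (a ^ 2 - 1) * (6 * a ^ 2 - 10 * a + 5) = 0)
    (hG : reducedF1 a b = 0) :
    F1 (numer a b / (3 * a * b)) a b = 0 ∧ F2 (numer a b / (3 * a * b)) a b = 0 ∧
      F3 (numer a b / (3 * a * b)) a b = 0 := by
  have hx : numer a b / (3 * a * b) * (3 * a * b) = numer a b :=
    div_mul_cancel₀ _ (by positivity)
  generalize numer a b / (3 * a * b) = x at hx ⊢
  have h3 : F3 x a b = 0 := by
    unfold F3
    unfold numer at hx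
    linear_combination -hx
  refine ⟨?_, ?_, h3⟩
  · have h : 9 * a ^ 2 * b ≠ 0 := by positivity
    apply mul_left_cancel₀ h
    unfold reducedF1 at hG
    rw [← hx] at hG
    unfold F1
    linear_combination hG
  · apply mul_left_cancel₀ ha.ne'
    unfold F3 at h3
    unfold F2
    linear_combination hq - (a ^ 2 - 1) * h3

lemma continuousOn_reducedF1_branch {σ : ℝ} {s : Set ℝ} (hs : ∀ a ∈ s, 5 - 6 * a ^ 2 ≠ 0) :
    ContinuousOn (fun a => reducedF1 a (branch σ a)) s := by
  have hb : ContinuousOn (branch σ) s := by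
    unfold branch elimDiscr
    exact ContinuousOn.div (by fun_prop) (by fun_prop) hs
  unfold reducedF1 numer
  fun_prop

lemma sqrt_mem_Icc {l u y : ℝ} (hu : 0 ≤ u) (h₁ : l ^ 2 ≤ y) (h₂ : y ≤ u ^ 2) :
    √y ∈ Set.Icc l u :=
  ⟨Real.le_sqrt_of_sq_le h₁, Real.sqrt_le_iff.mpr ⟨hu, h₂⟩⟩

lemma pow_mem_Icc {l u y : ℝ} (hl : 0 ≤ l) (h : y ∈ Set.Icc l u) (n : ℕ) :
    y ^ n ∈ Set.Icc (l ^ n) (u ^ n) :=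
  ⟨pow_le_pow_left₀ hl h.1 n, pow_le_pow_left₀ (hl.trans h.1) h.2 n⟩

lemma exists_root_on_branch {σ l u : ℝ} (hσ : σ ^ 2 = 1) (hlu : l ≤ u)
    (hD : ∀ a ∈ Set.Icc l u, 0 ≤ elimDiscr a) (hne : ∀ a ∈ Set.Icc l u, 5 - 6 * a ^ 2 ≠ 0)
    (hl : σ * reducedF1 l (branch σ l) ≤ 0) (hu : 0 ≤ σ * reducedF1 u (branch σ u)) :
    ∃ a ∈ Set.Icc l u,
      (5 - 6 * a ^ 2) * branch σ a ^ 2 + 10 * a * (a - 1) * branch σ a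
        + (a ^ 2 - 1) * (6 * a ^ 2 - 10 * a + 5) = 0 ∧
      reducedF1 a (branch σ a) = 0 := by
  have hc : ContinuousOn (fun a => σ * reducedF1 a (branch σ a)) (Set.Icc l u) :=
    continuousOn_const.mul (continuousOn_reducedF1_branch hne)
  obtain ⟨a, ha, h0⟩ := intermediate_value_Icc hlu hc ⟨hl, hu⟩
  have hσ0 : σ ≠ 0 := by
    rintro rfl
    norm_num at hσ
  exact ⟨a, ha, branch_root hσ (hD a ha) (hne a ha), (mul_eq_zero.mp h0).resolve_left hσ0⟩

lemma reducedF1_branch_neg_left : (-1) * reducedF1 1.01648 (branch (-1) 1.01648) ≤ (0 : ℝ) := by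
  have hs : √(elimDiscr 1.01648) ∈ Set.Icc 0.21966263 0.21966264 := by
    apply sqrt_mem_Icc <;> norm_num [elimDiscr]
  have hb : branch (-1) 1.01648 ∈ Set.Icc 0.2529790 0.2529793 := by
    obtain ⟨h₁, h₂⟩ := hs
    norm_num [branch] at h₁ h₂ ⊢
    constructor <;> linarith
  generalize branch (-1) 1.01648 = b at hb ⊢
  obtain ⟨h₂, h₂'⟩ := pow_mem_Icc (by norm_num) hb 2
  obtain ⟨h₃, h₃'⟩ := pow_mem_Icc (by norm_num) hb 3
  obtain ⟨h₄, h₄'⟩ := pow_mem_Icc (by norm_num) hb 4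
  obtain ⟨h₁, h₁'⟩ := hb
  norm_num at h₂ h₂' h₃ h₃' h₄ h₄'
  unfold reducedF1 numer
  linarith

lemma reducedF1_branch_neg_right : (0 : ℝ) ≤ (-1) * reducedF1 1.01656 (branch (-1) 1.01656) := by
  have hs : √(elimDiscr 1.01656) ∈ Set.Icc 0.22037161 0.22037162 := by
    apply sqrt_mem_Icc <;> norm_num [elimDiscr]
  have hb : branch (-1) 1.01656 ∈ Set.Icc 0.2537082 0.2537085 := by
    obtain ⟨h₁, h₂⟩ := hs
    norm_num [branch] at h₁ h₂ ⊢
    constructor <;> linarith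
  generalize branch (-1) 1.01656 = b at hb ⊢
  obtain ⟨h₂, h₂'⟩ := pow_mem_Icc (by norm_num) hb 2
  obtain ⟨h₃, h₃'⟩ := pow_mem_Icc (by norm_num) hb 3
  obtain ⟨h₄, h₄'⟩ := pow_mem_Icc (by norm_num) hb 4
  obtain ⟨h₁, h₁'⟩ := hb
  norm_num at h₂ h₂' h₃ h₃' h₄ h₄'
  unfold reducedF1 numer
  linarith

lemma reducedF1_branch_pos_left : 1 * reducedF1 0.669 (branch 1 0.669) ≤ (0 : ℝ) := by
  have hs : √(elimDiscr 0.669) ∈ Set.Icc 1.58071167 1.58071168 := by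
    apply sqrt_mem_Icc <;> norm_num [elimDiscr]
  have hb : branch 1 0.669 ∈ Set.Icc 1.1612662 1.1612665 := by
    obtain ⟨h₁, h₂⟩ := hs
    norm_num [branch] at h₁ h₂ ⊢
    constructor <;> linarith
  generalize branch 1 0.669 = b at hb ⊢
  obtain ⟨h₂, h₂'⟩ := pow_mem_Icc (by norm_num) hb 2
  obtain ⟨h₃, h₃'⟩ := pow_mem_Icc (by norm_num) hb 3
  obtain ⟨h₄, h₄'⟩ := pow_mem_Icc (by norm_num) hb 4
  obtain ⟨h₁, h₁'⟩ := hb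
  norm_num at h₂ h₂' h₃ h₃' h₄ h₄'
  unfold reducedF1 numer
  linarith

lemma reducedF1_branch_pos_right : (0 : ℝ) ≤ 1 * reducedF1 0.6692 (branch 1 0.6692) := by
  have hs : √(elimDiscr 0.6692) ∈ Set.Icc 1.57984112 1.57984113 := by
    apply sqrt_mem_Icc <;> norm_num [elimDiscr]
  have hb : branch 1 0.6692 ∈ Set.Icc 1.1615499 1.1615502 := by
    obtain ⟨h₁, h₂⟩ := hs
    norm_num [branch] at h₁ h₂ ⊢
    constructor <;> linarith
  generalize branch 1 0.6692 = b at hb ⊢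
  obtain ⟨h₂, h₂'⟩ := pow_mem_Icc (by norm_num) hb 2
  obtain ⟨h₃, h₃'⟩ := pow_mem_Icc (by norm_num) hb 3
  obtain ⟨h₄, h₄'⟩ := pow_mem_Icc (by norm_num) hb 4
  obtain ⟨h₁, h₁'⟩ := hb
  norm_num at h₂ h₂' h₃ h₃' h₄ h₄'
  unfold reducedF1 numer
  linarith

lemma elimDiscr_mem_neg {a : ℝ} (ha : a ∈ Set.Icc 1.01648 1.01656) :
    elimDiscr a ∈ Set.Icc (0.2196 ^ 2) (0.2204 ^ 2) := by
  obtain ⟨t, rfl⟩ : ∃ t, a = 1.01648 + t := ⟨a - 1.01648, by ring⟩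
  have ht : t ∈ Set.Icc 0 0.00008 := by constructor <;> linarith [ha.1, ha.2]
  obtain ⟨h₂, h₂'⟩ := pow_mem_Icc le_rfl ht 2
  obtain ⟨h₃, h₃'⟩ := pow_mem_Icc le_rfl ht 3
  obtain ⟨h₄, h₄'⟩ := pow_mem_Icc le_rfl ht 4
  obtain ⟨h₅, h₅'⟩ := pow_mem_Icc le_rfl ht 5
  obtain ⟨h₆, h₆'⟩ := pow_mem_Icc le_rfl ht 6
  obtain ⟨h₁, h₁'⟩ := ht
  norm_num at h₂ h₂' h₃ h₃' h₄ h₄' h₅ h₅' h₆ h₆'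
  unfold elimDiscr
  constructor <;> linarith

lemma branch_mem_neg {a : ℝ} (ha : a ∈ Set.Icc 1.01648 1.01656) :
    branch (-1) a ∈ Set.Icc 0.2529 0.2538 := by
  obtain ⟨hs, hs'⟩ := sqrt_mem_Icc (by norm_num) (elimDiscr_mem_neg ha).1 (elimDiscr_mem_neg ha).2
  obtain ⟨h, h'⟩ := ha
  have hq : 5 - 6 * a ^ 2 < 0 := by nlinarith
  unfold branch
  constructor
  · rw [le_div_iff_of_neg hq]
    nlinarith
  · rw [div_le_iff_of_neg hq]
    nlinarith

lemma elimDiscr_mem_pos {a : ℝ} (ha : a ∈ Set.Icc 0.669 0.6692) :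
    elimDiscr a ∈ Set.Icc (1.579 ^ 2) (1.582 ^ 2) := by
  obtain ⟨t, rfl⟩ : ∃ t, a = 0.669 + t := ⟨a - 0.669, by ring⟩
  have ht : t ∈ Set.Icc 0 0.0002 := by constructor <;> linarith [ha.1, ha.2]
  obtain ⟨h₂, h₂'⟩ := pow_mem_Icc le_rfl ht 2
  obtain ⟨h₃, h₃'⟩ := pow_mem_Icc le_rfl ht 3
  obtain ⟨h₄, h₄'⟩ := pow_mem_Icc le_rfl ht 4
  obtain ⟨h₅, h₅'⟩ := pow_mem_Icc le_rfl ht 5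
  obtain ⟨h₆, h₆'⟩ := pow_mem_Icc le_rfl ht 6
  obtain ⟨h₁, h₁'⟩ := ht
  norm_num at h₂ h₂' h₃ h₃' h₄ h₄' h₅ h₅' h₆ h₆'
  unfold elimDiscr
  constructor <;> linarith

lemma branch_mem_pos {a : ℝ} (ha : a ∈ Set.Icc 0.669 0.6692) :
    branch 1 a ∈ Set.Icc 1.16 1.163 := by
  obtain ⟨hs, hs'⟩ := sqrt_mem_Icc (by norm_num) (elimDiscr_mem_pos ha).1 (elimDiscr_mem_pos ha).2
  obtain ⟨h, h'⟩ := ha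
  have hq : 0 < 5 - 6 * a ^ 2 := by nlinarith
  unfold branch
  constructor
  · rw [le_div_iff₀ hq]
    nlinarith
  · rw [div_le_iff₀ hq]
    nlinarith

/-- The system `F1 = F2 = F3 = 0` has a solution with `0.24 < x2 < 0.25`, `1.01 < x12 < 1.02`,
`0.25 < x13 < 0.26`, and another with `0.28 < x2 < 0.30`, `0.66 < x12 < 0.68`,
`1.15 < x13 < 1.17`; in particular two distinct positive solutions with `x13 ≠ 1`. -/
theorem stmt19 :
    (∃ x2 x12 x13 : ℝ,
      0.24 < x2 ∧ x2 < 0.25 ∧ 1.01 < x12 ∧ x12 < 1.02 ∧ 0.25 < x13 ∧ x13 < 0.26 ∧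
      F1 x2 x12 x13 = 0 ∧ F2 x2 x12 x13 = 0 ∧ F3 x2 x12 x13 = 0) ∧
    (∃ x2 x12 x13 : ℝ,
      0.28 < x2 ∧ x2 < 0.30 ∧ 0.66 < x12 ∧ x12 < 0.68 ∧ 1.15 < x13 ∧ x13 < 1.17 ∧
      F1 x2 x12 x13 = 0 ∧ F2 x2 x12 x13 = 0 ∧ F3 x2 x12 x13 = 0) := by
  constructor
  · obtain ⟨a, ha, hq, hG⟩ := exists_root_on_branch (σ := (-1)) (l := 1.01648) (u := 1.01656)
      (by norm_num) (by norm_num)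
      (fun a ha => (sq_nonneg _).trans (elimDiscr_mem_neg ha).1)
      (fun a ha => by
        obtain ⟨h, h'⟩ := ha
        apply ne_of_lt
        nlinarith)
      reducedF1_branch_neg_left reducedF1_branch_neg_right
    obtain ⟨hb, hb'⟩ := branch_mem_neg ha
    obtain ⟨h, h'⟩ := ha
    generalize branch (-1) a = b at hq hG hb hb'
    have ha0 : 0 < a := by linarith
    have hb0 : 0 < b := by linarith
    refine ⟨numer a b / (3 * a * b), a, b, ?_, ?_, by linarith, by linarith, by linarith,
      by linarith, solution_of_reducedF1_eq_zero ha0 hb0 hq hG⟩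
    · rw [lt_div_iff₀ (by positivity)]
      unfold numer
      nlinarith
    · rw [div_lt_iff₀ (by positivity)]
      unfold numer
      nlinarith
  · obtain ⟨a, ha, hq, hG⟩ := exists_root_on_branch (σ := 1) (l := 0.669) (u := 0.6692)
      (by norm_num) (by norm_num)
      (fun a ha => (sq_nonneg _).trans (elimDiscr_mem_pos ha).1)
      (fun a ha => by
        obtain ⟨h, h'⟩ := ha
        apply ne_of_gt
        nlinarith)
      reducedF1_branch_pos_left reducedF1_branch_pos_right
    obtain ⟨hb, hb'⟩ := branch_mem_pos ha
    obtain ⟨h, h'⟩ := ha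
    generalize branch 1 a = b at hq hG hb hb'
    have ha0 : 0 < a := by linarith
    have hb0 : 0 < b := by linarith
    refine ⟨numer a b / (3 * a * b), a, b, ?_, ?_, by linarith, by linarith, by linarith,
      by linarith, solution_of_reducedF1_eq_zero ha0 hb0 hq hG⟩
    · rw [lt_div_iff₀ (by positivity)]
      unfold numer
      nlinarith
    · rw [div_lt_iff₀ (by positivity)]
      unfold numer
      nlinarith
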